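/- Let (λ_n) be a sequence of positive reals tending to infinity and set q_n = exp(-π/λ_n). Then (q_n; q_n)_∞ = √(2 λ_n) · exp(π/(24 λ_n) - π λ_n / 6) · (1 + O(exp(-4 π λ_n))) as n → ∞; in particular (q_n; q_n)_∞ · exp(π λ_n / 6 - π/(24 λ_n)) / √(2 λ_n) → 1. -/

import Mathlib

open Real Filter

/-- The real Euler product `∏ (1 - q ^ (k + 1))` agrees with the complex one. -/
lemma ofReal_tprod_one_sub_pow {q : ℝ} (hq : |q| < 1) :
    ((∏' k : ℕ, (1 - q ^ (k + 1)) : ℝ) : ℂ) = ∏' k : ℕ, (1 - (q : ℂ) ^ (k + 1)) := by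
  have hm : Multipliable fun k : ℕ => 1 - q ^ (k + 1) := by
    have hs : Summable fun k : ℕ => ‖-q ^ (k + 1)‖ := by
      simpa using (summable_nat_add_iff 1).mpr
        (summable_geometric_of_lt_one (abs_nonneg q) hq)
    simpa [sub_eq_add_neg] using multipliable_one_add_of_summable hs
  simpa using hm.map_tprod Complex.ofRealHom Complex.continuous_ofReal

/-- The Dedekind eta function on the positive imaginary axis. -/
lemma eta_ofReal_mul_I {t : ℝ} (ht : 0 < t) :
    ModularForm.eta (t * Complex.I) =
      ((rexp (-π * t / 12) * ∏' k : ℕ, (1 - rexp (-2 * π * t) ^ (k + 1)) : ℝ) : ℂ) := by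
  have hq : |rexp (-2 * π * t)| < 1 := by
    rw [abs_of_pos (exp_pos _), exp_lt_one_iff]
    have := mul_pos pi_pos ht
    linarith
  have h1 : Function.Periodic.qParam 1 (t * Complex.I) = (rexp (-2 * π * t) : ℝ) := by
    rw [Function.Periodic.qParam, Complex.ofReal_exp]
    congr 1
    push_cast
    linear_combination 2 * π * t * Complex.I_sq
  have h24 : Function.Periodic.qParam 24 (t * Complex.I) = (rexp (-π * t / 12) : ℝ) := by
    rw [Function.Periodic.qParam, Complex.ofReal_exp]
    congr 1
    push_cast
    linear_combination π * t / 12 * Complex.I_sq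
  rw [Complex.ofReal_mul, ofReal_tprod_one_sub_pow hq, ModularForm.eta, h24]
  simp only [ModularForm.eta_q, h1]

/-- The modular transformation of the Dedekind eta function on the positive imaginary axis. -/
lemma eta_inv_ofReal_mul_I {t : ℝ} (ht : 0 < t) :
    ModularForm.eta ((t⁻¹ : ℝ) * Complex.I) = √t * ModularForm.eta (t * Complex.I) := by
  have h := ModularForm.eta_comp_eq_csqrt_I_inv
    (show (t : ℂ) * Complex.I ∈ UpperHalfPlane.upperHalfPlaneSet by
      simpa [UpperHalfPlane.upperHalfPlaneSet] using ht)
  have hz : -1 / ((t : ℂ) * Complex.I) = (t⁻¹ : ℝ) * Complex.I := by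
    have : (t : ℂ) ≠ 0 := by exact_mod_cast ht.ne'
    push_cast
    field_simp
    simp
  have hs : Complex.sqrt (t * Complex.I) = √t * Complex.sqrt Complex.I := by
    have ht' : (t : ℂ) ≠ 0 := by exact_mod_cast ht.ne'
    rw [sqrt_eq_exp (mul_ne_zero ht' Complex.I_ne_zero),
      sqrt_eq_exp Complex.I_ne_zero, Complex.log_ofReal_mul ht Complex.I_ne_zero, add_div,
      Complex.exp_add, ← exp_log (sqrt_pos.mpr ht), log_sqrt ht.le]
    push_cast
    rfl
  have hI : Complex.sqrt Complex.I ≠ 0 := by simp [Complex.sqrt]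
  simp only [Function.comp_apply, Pi.smul_apply, Pi.mul_apply, smul_eq_mul, hz, hs] at h
  rw [h]
  field_simp

/-- The modular transformation of the Euler product. -/
lemma tprod_one_sub_exp_pow_eq {l : ℝ} (hl : 0 < l) :
    ∏' k : ℕ, (1 - rexp (-π / l) ^ (k + 1)) =
      √(2 * l) * rexp (π / (24 * l) - π * l / 6) *
        ∏' k : ℕ, (1 - rexp (-4 * π * l) ^ (k + 1)) := by
  have ht : 0 < 2 * l := by positivity
  have h := eta_inv_ofReal_mul_I ht
  rw [eta_ofReal_mul_I ht, eta_ofReal_mul_I (inv_pos.mpr ht), ← Complex.ofReal_mul,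
    Complex.ofReal_inj] at h
  rw [show -2 * π * (2 * l)⁻¹ = -π / l by field_simp,
    show -2 * π * (2 * l) = -4 * π * l by ring,
    show -π * (2 * l)⁻¹ / 12 = -(π / (24 * l)) by field_simp; norm_num,
    show -π * (2 * l) / 12 = -(π * l / 6) by ring, exp_neg, inv_mul_eq_iff_eq_mul₀ (exp_ne_zero _)]
    at h
  rw [h, sub_eq_add_neg, exp_add]
  ring

/-- The Euler product is `1 + O(q)` as `q → 0`. -/
lemma tprod_one_sub_pow_sub_one_isBigO :
    (fun q : ℝ => ∏' k : ℕ, (1 - q ^ (k + 1)) - 1) =O[nhds 0] fun q => q := by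
  have hd : DifferentiableAt ℂ (fun q : ℂ => ∏' k : ℕ, (1 - q ^ (k + 1))) 0 :=
    ModularForm.differentiableOn_tprod_one_sub_pow.differentiableAt
      (Metric.ball_mem_nhds 0 one_pos)
  have hO := hd.isBigO_sub.comp_tendsto
    (Complex.continuous_ofReal.tendsto' 0 0 Complex.ofReal_zero)
  refine (Asymptotics.isBigO_congr ?_ ?_).mp hO.norm_norm |>.of_norm_norm
  · filter_upwards [Metric.ball_mem_nhds (0 : ℝ) one_pos] with q hq
    have hq' : |q| < 1 := by simpa using hq
    simp only [Function.comp_apply, ← ofReal_tprod_one_sub_pow hq']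
    rw [← Complex.norm_real]
    simp
  · exact .of_forall fun q => by simp

theorem euler_product_asymptotics (lam : ℕ → ℝ) (hpos : ∀ n, 0 < lam n)
    (hlim : Tendsto lam atTop atTop) (q : ℕ → ℝ) (hq : ∀ n, q n = Real.exp (-π / lam n)) :
    (∃ C > 0, ∃ N : ℕ, ∀ n ≥ N,
      |(∏' k : ℕ, (1 - (q n) ^ (k + 1))) -
          Real.sqrt (2 * lam n) * Real.exp (π / (24 * lam n) - π * lam n / 6)| ≤
        Real.sqrt (2 * lam n) * Real.exp (π / (24 * lam n) - π * lam n / 6) *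
          (C * Real.exp (-4 * π * lam n))) ∧
    Tendsto (fun n => (∏' k : ℕ, (1 - (q n) ^ (k + 1))) *
        Real.exp (π * lam n / 6 - π / (24 * lam n)) / Real.sqrt (2 * lam n))
      atTop (nhds 1) := by
  have hw : Tendsto (fun n => rexp (-4 * π * lam n)) atTop (nhds 0) :=
    tendsto_exp_atBot.comp (hlim.const_mul_atTop_of_neg (by linarith [pi_pos]))
  have hO := tprod_one_sub_pow_sub_one_isBigO.comp_tendsto hw
  simp only [hq, tprod_one_sub_exp_pow_eq (hpos _)]
  constructor
  · obtain ⟨C, hC, hb⟩ := hO.exists_pos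
    obtain ⟨N, hN⟩ := eventually_atTop.mp hb.bound
    refine ⟨C, hC, N, fun n hn => ?_⟩
    have h := hN n hn
    simp only [Function.comp_apply, norm_eq_abs, abs_exp] at h
    rw [← mul_sub_one, abs_mul, abs_of_nonneg (by positivity)]
    gcongr
  · have h1 := (hO.trans_tendsto hw).add_const 1
    simp only [Function.comp_apply, sub_add_cancel, zero_add] at h1
    refine h1.congr fun n => ?_
    have hs : √(2 * lam n) ≠ 0 := (sqrt_pos.mpr (mul_pos two_pos (hpos n))).ne'
    rw [← neg_sub (π / (24 * lam n)), exp_neg]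
    field_simp
    exact (mul_div_cancel_right₀ _ (by rwa [mul_comm])).symm
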